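/- Let g = g₀ ⊕ g₁ be a finite-dimensional complex Lie superalgebra of basic type, and let M_triv be the isotypic component of the trivial [g₀,g₀]-module in g₁. Set g^{(2)} = [[g,g],[g,g]]. Then [M_triv, g^{(2)}₁] = 0, where g^{(2)}₁ denotes the odd part of g^{(2)}. -/

import Mathlib

open scoped BigOperators Classical
open Module

noncomputable section

/-- A complex Lie superalgebra structure on `L`: a `ℤ/2`-grading `L = g0 ⊕ g1`
together with a bilinear bracket which preserves the grading, is
super-skew-symmetric and satisfies the super Jacobi identity. -/
structure SuperData (L : Type*) [AddCommGroup L] [Module ℂ L] where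
  g0 : Submodule ℂ L
  g1 : Submodule ℂ L
  compl : IsCompl g0 g1
  br : L →ₗ[ℂ] L →ₗ[ℂ] L
  br00 : ∀ x ∈ g0, ∀ y ∈ g0, br x y ∈ g0
  br01 : ∀ x ∈ g0, ∀ y ∈ g1, br x y ∈ g1
  br10 : ∀ x ∈ g1, ∀ y ∈ g0, br x y ∈ g1
  br11 : ∀ x ∈ g1, ∀ y ∈ g1, br x y ∈ g0
  skew_e : ∀ x ∈ g0, ∀ y : L, br x y = - br y x
  skew_o : ∀ x ∈ g1, ∀ y ∈ g1, br x y = br y x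
  jac_e : ∀ x ∈ g0, ∀ y z : L, br x (br y z) = br (br x y) z + br y (br x z)
  jac_oe : ∀ x ∈ g1, ∀ y ∈ g0, ∀ z : L, br x (br y z) = br (br x y) z + br y (br x z)
  jac_oo : ∀ x ∈ g1, ∀ y ∈ g1, ∀ z : L, br x (br y z) = br (br x y) z - br y (br x z)

namespace SuperData

variable {L : Type*} [AddCommGroup L] [Module ℂ L] (S : SuperData L)

/-- The span of all brackets `[P, Q]`. -/
def brSpan (P Q : Submodule ℂ L) : Submodule ℂ L :=
  Submodule.span ℂ {z : L | ∃ x ∈ P, ∃ y ∈ Q, S.br x y = z}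

/-- The derived subalgebra `g⁽¹⁾ = [g, g]`. -/
def derived : Submodule ℂ L := S.brSpan ⊤ ⊤

/-- The second derived subalgebra `g⁽²⁾ = [[g,g],[g,g]]`. -/
def derived2 : Submodule ℂ L := S.brSpan S.derived S.derived

/-- The center `𝔷(g)` of the Lie superalgebra. -/
def center : Submodule ℂ L := ⨅ y : L, LinearMap.ker (S.br.flip y)

/-- Ideals of the Lie superalgebra. -/
def IsIdeal (I : Submodule ℂ L) : Prop := ∀ x : L, ∀ y ∈ I, S.br x y ∈ I

/-- `ℤ/2`-graded subspaces. -/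
def IsGraded (I : Submodule ℂ L) : Prop := I = I ⊓ S.g0 ⊔ I ⊓ S.g1

/-- Subalgebras (bracket-closed subspaces). -/
def IsSubalgebra (W : Submodule ℂ L) : Prop := ∀ x ∈ W, ∀ y ∈ W, S.br x y ∈ W

/-- A Cartan subalgebra of the reductive even part `g0`:
an abelian self-normalizing subalgebra of `g0`. -/
def IsCartan (h : Submodule ℂ L) : Prop :=
  h ≤ S.g0 ∧ (∀ x ∈ h, ∀ y ∈ h, S.br x y = 0) ∧
    ∀ x ∈ S.g0, (∀ y ∈ h, S.br x y ∈ h) → x ∈ h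

/-- The weight space of weight `α` relative to the Cartan subalgebra `h`,
inside the `h`-stable subspace `W`. -/
def wsp (h W : Submodule ℂ L) (α : Module.Dual ℂ L) : Submodule ℂ L :=
  W ⊓ ⨅ t : h, LinearMap.ker (S.br (t : L) - α (t : L) • (LinearMap.id : L →ₗ[ℂ] L))

/-- The superdimension `sdim W = dim W₀ - dim W₁` of a subspace. -/
def sdim (W : Submodule ℂ L) : ℤ :=
  (Module.finrank ℂ ↥(W ⊓ S.g0) : ℤ) - (Module.finrank ℂ ↥(W ⊓ S.g1) : ℤ)

/-- The Casimir operator `Ω_g(a) = ∑ i [xⁱ,[x_i,a]]` attached to a pair of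
dual bases `{x_i}`, `{xⁱ}`. -/
def casimir {ι : Type*} [Fintype ι] (b d : ι → L) : L →ₗ[ℂ] L :=
  ∑ i, (S.br (d i)) ∘ₗ (S.br (b i))

end SuperData

/-- A quadratic Lie superalgebra: a Lie superalgebra with a nondegenerate
invariant supersymmetric bilinear form. -/
structure QuadSuperData (L : Type*) [AddCommGroup L] [Module ℂ L] extends SuperData L where
  B : L →ₗ[ℂ] L →ₗ[ℂ] ℂ
  B_symm : ∀ x ∈ g0, ∀ y ∈ g0, B x y = B y x
  B_alt : ∀ x ∈ g1, ∀ y ∈ g1, B x y = - B y x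
  B_ortho : ∀ x ∈ g0, ∀ y ∈ g1, B x y = 0
  B_nondeg : ∀ x : L, (∀ y : L, B x y = 0) → x = 0
  B_inv : ∀ x y z : L, B (br x y) z = B x (br y z)

namespace QuadSuperData

variable {L : Type*} [AddCommGroup L] [Module ℂ L] (S : QuadSuperData L)

/-- Isotropic subspaces for the invariant form. -/
def IsIsotropic (W : Submodule ℂ L) : Prop := ∀ x ∈ W, ∀ y ∈ W, S.B x y = 0

/-- Maximal isotropic subspaces for the invariant form. -/
def IsMaxIsotropic (W : Submodule ℂ L) : Prop :=
  S.IsIsotropic W ∧ ∀ W' : Submodule ℂ L, S.IsIsotropic W' → W ≤ W' → W' = W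

end QuadSuperData

/-- A Lie superalgebra of basic type: quadratic, and `g0` is a reductive
subalgebra of `g`, i.e. the adjoint action of `g0` on `g` is completely
reducible. -/
structure BasicSuperData (L : Type*) [AddCommGroup L] [Module ℂ L] extends QuadSuperData L where
  reductive : ∀ W : Submodule ℂ L, (∀ x ∈ g0, ∀ w ∈ W, br x w ∈ W) →
    ∃ W' : Submodule ℂ L, (∀ x ∈ g0, ∀ w ∈ W', br x w ∈ W') ∧ IsCompl W W'

namespace SuperData

variable {L : Type*} [AddCommGroup L] [Module ℂ L] (S : SuperData L)

/-- The odd vectors annihilated by `[g0, g0]`. -/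
def oddInvariants : Submodule ℂ L :=
  S.g1 ⊓ ⨅ y : S.brSpan S.g0 S.g0, LinearMap.ker (S.br (y : L))

/-- The span `[[g0, g0], g1]`. -/
def oddCoinvariants : Submodule ℂ L :=
  S.brSpan (S.brSpan S.g0 S.g0) S.g1

theorem mem_oddInvariants {m : L} :
    m ∈ S.oddInvariants ↔ m ∈ S.g1 ∧ ∀ y ∈ S.brSpan S.g0 S.g0, S.br y m = 0 := by
  simp [oddInvariants]

theorem br_mem_brSpan {P Q : Submodule ℂ L} {x y : L} (hx : x ∈ P) (hy : y ∈ Q) :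
    S.br x y ∈ S.brSpan P Q :=
  Submodule.subset_span ⟨x, hx, y, hy, rfl⟩

theorem brSpan_le {P Q R : Submodule ℂ L} (h : ∀ x ∈ P, ∀ y ∈ Q, S.br x y ∈ R) :
    S.brSpan P Q ≤ R := by
  refine Submodule.span_le.2 ?_
  rintro _ ⟨x, hx, y, hy, rfl⟩
  exact h x hx y hy

theorem brSpan_g0_g0_le : S.brSpan S.g0 S.g0 ≤ S.g0 :=
  S.brSpan_le S.br00

theorem oddCoinvariants_le : S.oddCoinvariants ≤ S.g1 :=
  S.brSpan_le fun y hy x hx => S.br01 y (S.brSpan_g0_g0_le hy) x hx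

theorem br_mem_oddCoinvariants {h : L} (hh : h ∈ S.g0) {n : L} (hn : n ∈ S.oddCoinvariants) :
    S.br h n ∈ S.oddCoinvariants := by
  suffices S.oddCoinvariants ≤ S.oddCoinvariants.comap (S.br h) from this hn
  refine S.brSpan_le fun y hy x hx => ?_
  have hy0 := S.brSpan_g0_g0_le hy
  rw [Submodule.mem_comap, S.jac_e h hh y x]
  exact add_mem (S.br_mem_brSpan (S.br_mem_brSpan hh hy0) hx)
    (S.br_mem_brSpan hy (S.br01 h hh x hx))

theorem exists_even_add_odd (x : L) : ∃ a ∈ S.g0, ∃ b ∈ S.g1, a + b = x := by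
  have hx : x ∈ S.g0 ⊔ S.g1 := by rw [S.compl.sup_eq_top]; trivial
  exact Submodule.mem_sup.1 hx

theorem derived_le :
    S.derived ≤ (S.brSpan S.g0 S.g0 ⊔ S.brSpan S.g1 S.g1) ⊔ S.g1 := by
  refine S.brSpan_le fun x _ y _ => ?_
  obtain ⟨a, ha, b, hb, rfl⟩ := S.exists_even_add_odd x
  obtain ⟨c, hc, d, hd, rfl⟩ := S.exists_even_add_odd y
  have h00 := S.br_mem_brSpan ha hc
  have h11 := S.br_mem_brSpan hb hd
  have h01 := add_mem (S.br01 a ha d hd) (S.br10 b hb c hc)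
  have key : S.br (a + b) (c + d)
      = (S.br a c + S.br b d) + (S.br a d + S.br b c) := by
    simp only [map_add, LinearMap.add_apply]; abel
  rw [key]
  exact Submodule.add_mem_sup (Submodule.add_mem_sup h00 h11) h01

/-- For odd `a`, the square of `ad [a, a]` annihilates every `b` such that `[a, a]` commutes
with `[a, b]`. -/
theorem br_self_br_self_eq_zero {a b : L} (ha : a ∈ S.g1)
    (hab : S.br (S.br a a) (S.br a b) = 0) :
    S.br (S.br a a) (S.br (S.br a a) b) = 0 := by
  have h0 := S.br11 a ha a ha
  have haa : S.br (S.br a a) a = 0 := by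
    have h1 := S.jac_oo a ha a ha a
    have h2 := S.skew_e _ h0 a
    have h3 : (3 : ℂ) • S.br (S.br a a) a = 0 := by
      rw [← neg_eq_iff_eq_neg] at h2
      rw [← h2] at h1
      calc (3 : ℂ) • S.br (S.br a a) a
          = S.br (S.br a a) a - -S.br (S.br a a) a + S.br (S.br a a) a := by module
        _ = 0 := by rw [← h1, neg_add_cancel]
    exact (smul_eq_zero.1 h3).resolve_left (by norm_num)
  have hb : S.br (S.br a a) b = (2 : ℂ) • S.br a (S.br a b) := by
    rw [two_smul]
    exact (eq_sub_iff_add_eq.1 (S.jac_oo a ha a ha b)).symm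
  rw [hb, map_smul, S.jac_e _ h0, haa, hab]
  simp

end SuperData

namespace QuadSuperData

variable {L : Type*} [AddCommGroup L] [Module ℂ L] (S : QuadSuperData L)

theorem eq_zero_of_forall_B_g0 {x : L} (hx : x ∈ S.g0) (h : ∀ y ∈ S.g0, S.B x y = 0) :
    x = 0 := by
  refine S.B_nondeg x fun y => ?_
  obtain ⟨a, ha, b, hb, rfl⟩ := S.exists_even_add_odd y
  rw [map_add, h a ha, S.B_ortho x hx b hb, add_zero]

theorem br_oddInvariants_oddCoinvariants {m n : L} (hm : m ∈ S.oddInvariants)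
    (hn : n ∈ S.oddCoinvariants) : S.br m n = 0 := by
  obtain ⟨hm1, hm⟩ := S.mem_oddInvariants.1 hm
  have hortho : S.oddCoinvariants ≤ LinearMap.ker (S.B m) := by
    refine S.brSpan_le fun y hy x _ => ?_
    have hmy : S.br m y = 0 := by
      rw [← neg_eq_zero, ← S.skew_e y (S.brSpan_g0_g0_le hy), hm y hy]
    rw [LinearMap.mem_ker, ← S.B_inv, hmy, map_zero, LinearMap.zero_apply]
  refine S.eq_zero_of_forall_B_g0 (S.br11 m hm1 n (S.oddCoinvariants_le hn)) fun h hh => ?_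
  have hnh : S.br n h = -S.br h n := by rw [S.skew_e h hh, neg_neg]
  rw [S.B_inv, hnh, map_neg, neg_eq_zero]
  exact hortho (S.br_mem_oddCoinvariants hh hn)

theorem br_br_oddInvariants_eq_zero {a b y : L} (ha : a ∈ S.oddInvariants)
    (hb : b ∈ S.oddInvariants) (hy : y ∈ S.g0) : S.br (S.br a b) y = 0 := by
  obtain ⟨ha1, -⟩ := S.mem_oddInvariants.1 ha
  obtain ⟨hb1, hb⟩ := S.mem_oddInvariants.1 hb
  have hab := S.br11 a ha1 b hb1
  refine S.eq_zero_of_forall_B_g0 (S.br00 _ hab y hy) fun x hx => ?_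
  have hbr : S.br b (S.br y x) = 0 := by
    rw [← neg_eq_zero, ← S.skew_e _ (S.br00 y hy x hx), hb _ (S.br_mem_brSpan hy hx)]
  rw [S.B_inv, S.B_inv, hbr, map_zero]

end QuadSuperData

namespace BasicSuperData

variable {L : Type*} [AddCommGroup L] [Module ℂ L] (S : BasicSuperData L)

theorem exists_oddInvariants_add {x : L} (hx : x ∈ S.g1) :
    ∃ m ∈ S.oddInvariants, ∃ n ∈ S.oddCoinvariants, m + n = x := by
  obtain ⟨W, hW, hc⟩ := S.reductive S.oddCoinvariants
    fun h hh n hn => S.br_mem_oddCoinvariants hh hn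
  have hx' : x ∈ S.oddCoinvariants ⊔ W := by rw [hc.sup_eq_top]; trivial
  obtain ⟨n, hn, w, hw, rfl⟩ := Submodule.mem_sup.1 hx'
  have hw1 : w ∈ S.g1 := (Submodule.add_mem_iff_right _ (S.oddCoinvariants_le hn)).1 hx
  refine ⟨w, S.mem_oddInvariants.2 ⟨hw1, fun y hy => ?_⟩, n, hn, add_comm _ _⟩
  exact Submodule.disjoint_def.1 hc.disjoint _ (S.br_mem_brSpan hy hw1)
    (hW y (S.brSpan_g0_g0_le hy) w hw)

/-- Central elements of `g0` act semisimply, so a vector killed by the square of such an element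
is killed by the element. -/
theorem br_eq_zero_of_br_br_eq_zero {h : L} (hh : h ∈ S.g0)
    (hcentral : ∀ y ∈ S.g0, S.br h y = 0) {x : L} (hx : S.br h (S.br h x) = 0) :
    S.br h x = 0 := by
  obtain ⟨W, hW, hc⟩ := S.reductive (LinearMap.ker (S.br h)) fun y hy w hw => by
    rw [LinearMap.mem_ker] at hw ⊢
    rw [S.jac_e h hh, hcentral y hy, hw]
    simp
  have hx' : x ∈ LinearMap.ker (S.br h) ⊔ W := by rw [hc.sup_eq_top]; trivial
  obtain ⟨k, hk, w, hw, rfl⟩ := Submodule.mem_sup.1 hx'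
  rw [LinearMap.mem_ker] at hk
  refine Submodule.disjoint_def.1 hc.disjoint _ hx ?_
  rw [map_add, hk, zero_add]
  exact hW h hh w hw

theorem br_br_self_oddInvariants {a b : L} (ha : a ∈ S.oddInvariants)
    (hb : b ∈ S.oddInvariants) : S.br (S.br a a) b = 0 := by
  have ha1 := (S.mem_oddInvariants.1 ha).1
  have hb1 := (S.mem_oddInvariants.1 hb).1
  have hcentral : ∀ y ∈ S.g0, S.br (S.br a a) y = 0 :=
    fun y hy => S.br_br_oddInvariants_eq_zero ha ha hy
  exact S.br_eq_zero_of_br_br_eq_zero (S.br11 a ha1 a ha1) hcentral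
    (S.br_self_br_self_eq_zero ha1 (hcentral _ (S.br11 a ha1 b hb1)))

theorem br_br_oddInvariants {a b c : L} (ha : a ∈ S.oddInvariants)
    (hb : b ∈ S.oddInvariants) (hc : c ∈ S.oddInvariants) : S.br (S.br a b) c = 0 := by
  have h := S.br_br_self_oddInvariants (add_mem ha hb) hc
  have hba := S.skew_o b (S.mem_oddInvariants.1 hb).1 a (S.mem_oddInvariants.1 ha).1
  simp only [map_add, LinearMap.add_apply, hba, S.br_br_self_oddInvariants ha hc,
    S.br_br_self_oddInvariants hb hc, zero_add, add_zero] at h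
  rw [← two_smul ℂ] at h
  exact (smul_eq_zero.1 h).resolve_left two_ne_zero

theorem br_br_odd_oddInvariants {a b m : L} (ha : a ∈ S.g1) (hb : b ∈ S.g1)
    (hm : m ∈ S.oddInvariants) : S.br (S.br a b) m = 0 := by
  obtain ⟨a, ham, a', han, rfl⟩ := S.exists_oddInvariants_add ha
  obtain ⟨b, hbm, b', hbn, rfl⟩ := S.exists_oddInvariants_add hb
  have ha1 := (S.mem_oddInvariants.1 ham).1
  have hb1 := (S.mem_oddInvariants.1 hbm).1
  have hm1 := (S.mem_oddInvariants.1 hm).1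
  have ha'1 := S.oddCoinvariants_le han
  have hb'1 := S.oddCoinvariants_le hbn
  have hab' : S.br a b' = 0 := S.br_oddInvariants_oddCoinvariants ham hbn
  have ha'b : S.br a' b = 0 := by
    rw [S.skew_o a' ha'1 b hb1]
    exact S.br_oddInvariants_oddCoinvariants hbm han
  have ha'm : S.br a' m = 0 := by
    rw [S.skew_o a' ha'1 m hm1]
    exact S.br_oddInvariants_oddCoinvariants hm han
  have hb'm : S.br b' m = 0 := by
    rw [S.skew_o b' hb'1 m hm1]
    exact S.br_oddInvariants_oddCoinvariants hm hbn
  have hnn : S.br (S.br a' b') m = 0 := by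
    have h := S.jac_oo a' ha'1 b' hb'1 m
    rw [ha'm, hb'm, map_zero, map_zero, sub_zero] at h
    exact h.symm
  simp only [map_add, LinearMap.add_apply, hab', ha'b, hnn, S.br_br_oddInvariants ham hbm hm,
    LinearMap.zero_apply, map_zero, add_zero]

theorem br_even_derived_mem {d y : L}
    (hd : d ∈ S.brSpan S.g0 S.g0 ⊔ S.brSpan S.g1 S.g1) (hy : y ∈ S.g1) :
    S.br d y ∈ S.oddCoinvariants := by
  suffices S.brSpan S.g0 S.g0 ⊔ S.brSpan S.g1 S.g1 ≤ S.oddCoinvariants.comap (S.br.flip y) from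
    this hd
  refine sup_le (fun s hs => S.br_mem_brSpan hs hy) (S.brSpan_le fun a ha b hb => ?_)
  obtain ⟨m, hm, n, hn, rfl⟩ := S.exists_oddInvariants_add hy
  rw [Submodule.mem_comap, LinearMap.flip_apply, map_add, S.br_br_odd_oddInvariants ha hb hm,
    zero_add]
  exact S.br_mem_oddCoinvariants (S.br11 a ha b hb) hn

theorem derived2_le : S.derived2 ≤ S.g0 ⊔ S.oddCoinvariants := by
  refine S.brSpan_le fun p hp q hq => ?_
  obtain ⟨d, hd, x, hx, rfl⟩ := Submodule.mem_sup.1 (S.derived_le hp)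
  obtain ⟨e, he, y, hy, rfl⟩ := Submodule.mem_sup.1 (S.derived_le hq)
  have hle : S.brSpan S.g0 S.g0 ⊔ S.brSpan S.g1 S.g1 ≤ S.g0 :=
    sup_le S.brSpan_g0_g0_le (S.brSpan_le S.br11)
  have key : S.br (d + x) (e + y)
      = (S.br d e + S.br x y) + (S.br d y - S.br e x) := by
    rw [S.skew_e e (hle he) x]
    simp only [map_add, LinearMap.add_apply]
    abel
  rw [key]
  exact Submodule.add_mem_sup (add_mem (S.br00 d (hle hd) e (hle he)) (S.br11 x hx y hy))
    (sub_mem (S.br_even_derived_mem hd hy) (S.br_even_derived_mem he hx))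

theorem derived2_inf_g1_le : S.derived2 ⊓ S.g1 ≤ S.oddCoinvariants := by
  rintro z ⟨hz, hz1⟩
  obtain ⟨u, hu, n, hn, rfl⟩ := Submodule.mem_sup.1 (S.derived2_le hz)
  have hu1 : u ∈ S.g1 := (Submodule.add_mem_iff_left _ (S.oddCoinvariants_le hn)).1 hz1
  rwa [Submodule.disjoint_def.1 S.compl.disjoint u hu hu1, zero_add]

end BasicSuperData

/-- for a finite-dimensional complex Lie superalgebra of basic
type, the isotypic component `M_triv` of the trivial `[g0,g0]`-module in `g1`
(i.e. the set of odd vectors annihilated by `[g0,g0]`) brackets to zero with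
the odd part of `g⁽²⁾ = [[g,g],[g,g]]`. -/
theorem trivial_isotypic_commutes_with_derived2_odd
    {L : Type*} [AddCommGroup L] [Module ℂ L] [FiniteDimensional ℂ L]
    (S : BasicSuperData L) :
    ∀ m ∈ S.g1, (∀ y ∈ S.brSpan S.g0 S.g0, S.br y m = 0) →
      ∀ z ∈ S.derived2 ⊓ S.g1, S.br m z = 0 := by
  intro m hm hinv z hz
  exact S.br_oddInvariants_oddCoinvariants (S.mem_oddInvariants.2 ⟨hm, hinv⟩)
    (S.derived2_inf_g1_le hz)
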